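/- Fix an integer p ≥ 1, d > 0, a positive integer N, Δx = d/N and ω = 2π/d, and let λ_k = Σ_{j=1}^p α_j sin(ωkjΔx)/(jΔx) and μ_k = Σ_{j=1}^p α_j (2 − 2cos(ωkjΔx))/(jΔx)² with α_j = 2(−1)^{j+1}(p!)²/((p+j)!(p−j)!). Then for every real k the following estimates hold: |ωk − λ_k| ≤ ((p!)²/(2p+1)!) |ωk|^{2p+1} (Δx)^{2p}, |ω²k² − λ_k²| ≤ (2(p!)²/(2p+1)!) |ωk|^{2p+2} (Δx)^{2p}, and |ω²k² − μ_k| ≤ (2(p!)²/(2p+2)!) |ωk|^{2p+2} (Δx)^{2p}. -/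

import Mathlib

open Real

/-- The finite-difference coefficients `α_j = 2(−1)^{j+1}(p!)²/((p+j)!(p−j)!)`. -/
noncomputable def fdAlpha (p j : ℕ) : ℝ :=
  2 * (-1 : ℝ) ^ (j + 1) * (p.factorial : ℝ) ^ 2 /
    ((p + j).factorial * (p - j).factorial)

/-- The eigenvalue symbol `λ_k = Σ_{j=1}^p α_j sin(ωkjΔx)/(jΔx)` of `D_{2p}`. -/
noncomputable def fdLambda (p : ℕ) (ω Δx : ℝ) (k : ℝ) : ℝ :=
  ∑ j ∈ Finset.Icc 1 p, fdAlpha p j * Real.sin (ω * k * j * Δx) / (j * Δx)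

/-- The eigenvalue symbol `μ_k = Σ_{j=1}^p α_j (2 − 2cos(ωkjΔx))/(jΔx)²` of `D^{(2)}_{2p}`. -/
noncomputable def fdMu (p : ℕ) (ω Δx : ℝ) (k : ℝ) : ℝ :=
  ∑ j ∈ Finset.Icc 1 p, fdAlpha p j * (2 - 2 * Real.cos (ω * k * j * Δx)) / (j * Δx) ^ 2

/-- Splitting a sum over `{0, …, 2p}` around its central term. -/
lemma sum_range_two_mul_add_one_eq_center {M : Type*} [AddCommMonoid M] (p : ℕ) (f : ℕ → M) :
    ∑ m ∈ Finset.range (2 * p + 1), f m =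
      f p + ∑ j ∈ Finset.Icc 1 p, (f (p - j) + f (p + j)) := by
  have h1 : ∑ j ∈ Finset.Icc 1 p, (f (p - j) + f (p + j)) =
      ∑ i ∈ Finset.range p, (f (p - 1 - i) + f (p + (i + 1))) := by
    rw [← Finset.Ico_add_one_right_eq_Icc, Finset.sum_Ico_eq_sum_range]
    refine Finset.sum_congr (by simp) fun i _ => ?_
    rw [Nat.sub_sub, add_comm 1 i]
  rw [h1, Finset.sum_add_distrib, Finset.sum_range_reflect f p,
    show 2 * p + 1 = p + (p + 1) by ring, Finset.sum_range_add, Finset.sum_range_succ']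
  simp only [add_zero]
  ac_rfl

lemma two_sub_two_mul_cos_pow_eq_sum (p : ℕ) (θ : ℝ) :
    (2 - 2 * cos θ) ^ p =
      (-1) ^ p * ∑ m ∈ Finset.range (2 * p + 1),
        (-1 : ℝ) ^ m * ((2 * p).choose m : ℝ) * cos (((m : ℝ) - p) * θ) := by
  set w : ℂ := Complex.exp (((θ / 2 : ℝ) : ℂ) * Complex.I) with hw
  set v : ℂ := Complex.exp (-(((θ / 2 : ℝ) : ℂ) * Complex.I)) with hv
  have hsq : (w + -v) ^ 2 = ((-(2 - 2 * cos θ) : ℝ) : ℂ) := by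
    have hwv : w * v = 1 := by rw [hw, hv, ← Complex.exp_add]; simp
    have hw2 : w ^ 2 = Complex.exp ((θ : ℂ) * Complex.I) := by
      rw [hw, ← Complex.exp_nat_mul]; congr 1; push_cast; ring
    have hv2 : v ^ 2 = Complex.exp (-(θ : ℂ) * Complex.I) := by
      rw [hv, ← Complex.exp_nat_mul]; congr 1; push_cast; ring
    push_cast
    rw [Complex.two_cos, ← hw2, ← hv2]
    linear_combination (-2) * hwv
  have hexp : (w + -v) ^ (2 * p) = ∑ m ∈ Finset.range (2 * p + 1),
      (((-1 : ℝ) ^ m * ((2 * p).choose m : ℝ) : ℝ) : ℂ) *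
        Complex.exp (((((m : ℝ) - p) * θ : ℝ) : ℂ) * Complex.I) := by
    rw [add_pow]
    refine Finset.sum_congr rfl fun m hm => ?_
    have hm' : m ≤ 2 * p := Nat.lt_succ_iff.mp (Finset.mem_range.mp hm)
    have hsign : (-1 : ℂ) ^ (2 * p - m) = (-1) ^ m := by
      have h : (-1 : ℂ) ^ (2 * p - m) * (-1) ^ m = 1 := by
        rw [← pow_add, Nat.sub_add_cancel hm', pow_mul]; simp
      have h' : (-1 : ℂ) ^ m * (-1) ^ m = 1 := by
        rw [← mul_pow]; simp
      calc (-1 : ℂ) ^ (2 * p - m) = (-1 : ℂ) ^ (2 * p - m) * ((-1) ^ m * (-1) ^ m) := by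
            rw [h', mul_one]
        _ = (-1) ^ m := by rw [← mul_assoc, h, one_mul]
    have hwv : w ^ m * v ^ (2 * p - m) =
        Complex.exp (((((m : ℝ) - p) * θ : ℝ) : ℂ) * Complex.I) := by
      rw [hw, hv, ← Complex.exp_nat_mul, ← Complex.exp_nat_mul, ← Complex.exp_add]
      congr 1
      push_cast [Nat.cast_sub hm']
      ring
    rw [neg_pow, hsign, ← hwv]
    push_cast
    ring
  have hre := congrArg Complex.re (hexp.symm.trans (by rw [pow_mul, hsq]))
  rw [Complex.re_sum, ← Complex.ofReal_pow, Complex.ofReal_re, neg_pow] at hre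
  simp only [Complex.re_ofReal_mul, Complex.exp_ofReal_mul_I_re] at hre
  rw [hre, ← mul_assoc, ← mul_pow]
  simp

/-- The defect of the Fourier symbol of the derivative of `fdLambda`. -/
lemma one_sub_sum_fdAlpha_mul_cos (p : ℕ) (θ : ℝ) :
    1 - ∑ j ∈ Finset.Icc 1 p, fdAlpha p j * cos (j * θ) =
      (p.factorial : ℝ) ^ 2 / (2 * p).factorial * (2 - 2 * cos θ) ^ p := by
  have hsq : ∀ n : ℕ, (-1 : ℝ) ^ n * (-1) ^ n = 1 := fun n => by rw [← mul_pow]; simp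
  rw [two_sub_two_mul_cos_pow_eq_sum, sum_range_two_mul_add_one_eq_center, mul_add, mul_add,
    sub_eq_add_neg, ← Finset.sum_neg_distrib, Finset.mul_sum, Finset.mul_sum]
  have hfac : ∀ n : ℕ, (n.factorial : ℝ) ≠ 0 := fun n => by positivity
  congr 1
  · have hc : ((2 * p).choose p : ℝ) = (2 * p).factorial / (p.factorial * p.factorial) := by
      rw [Nat.cast_choose ℝ (by omega : p ≤ 2 * p), show 2 * p - p = p by omega]
    have h1 := hsq p
    have := hfac p
    have := hfac (2 * p)
    simp only [sub_self, zero_mul, cos_zero, mul_one, hc]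
    field_simp
    linear_combination -h1
  · refine Finset.sum_congr rfl fun j hj => ?_
    have hj' : j ≤ p := (Finset.mem_Icc.mp hj).2
    have hc1 : ((2 * p).choose (p + j) : ℝ) =
        (2 * p).factorial / ((p + j).factorial * (p - j).factorial) := by
      rw [Nat.cast_choose ℝ (by omega : p + j ≤ 2 * p), show 2 * p - (p + j) = p - j by omega]
    have hc2 : ((2 * p).choose (p - j) : ℝ) =
        (2 * p).factorial / ((p + j).factorial * (p - j).factorial) := by
      rw [Nat.cast_choose ℝ (by omega : p - j ≤ 2 * p), show 2 * p - (p - j) = p + j by omega,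
        mul_comm ((p - j).factorial : ℝ)]
    have hs1 : (-1 : ℝ) ^ (p - j) = (-1) ^ (p + j) := by
      rw [show p + j = (p - j) + 2 * j by omega, pow_add, pow_mul]; simp
    have hcos1 : cos (((p - j : ℕ) - (p : ℝ)) * θ) = cos (j * θ) := by
      rw [Nat.cast_sub hj', ← cos_neg]; congr 1; ring
    have hcos2 : cos (((p + j : ℕ) - (p : ℝ)) * θ) = cos (j * θ) := by
      push_cast; congr 1; ring
    rw [hc1, hc2, hs1, hcos1, hcos2, fdAlpha, pow_add, pow_succ]
    have h1 := hsq p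
    have := hfac (p + j)
    have := hfac (p - j)
    have := hfac (2 * p)
    field_simp
    linear_combination (-2 * cos (j * θ) * (-1) ^ j) * h1

lemma two_sub_two_mul_cos_nonneg (θ : ℝ) : 0 ≤ 2 - 2 * cos θ := by
  linarith [cos_le_one θ]

lemma one_sub_sum_fdAlpha_mul_cos_nonneg (p : ℕ) (θ : ℝ) :
    0 ≤ 1 - ∑ j ∈ Finset.Icc 1 p, fdAlpha p j * cos (j * θ) := by
  rw [one_sub_sum_fdAlpha_mul_cos]
  have := two_sub_two_mul_cos_nonneg θ
  positivity

lemma one_sub_sum_fdAlpha_mul_cos_le (p : ℕ) (θ : ℝ) :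
    1 - ∑ j ∈ Finset.Icc 1 p, fdAlpha p j * cos (j * θ) ≤
      (p.factorial : ℝ) ^ 2 / (2 * p).factorial * θ ^ (2 * p) := by
  rw [one_sub_sum_fdAlpha_mul_cos, pow_mul]
  have := two_sub_two_mul_cos_nonneg θ
  have : 2 - 2 * cos θ ≤ θ ^ 2 := by linarith [one_sub_sq_div_two_le_cos (x := θ)]
  gcongr

lemma le_of_hasDerivAt_le_of_nonneg {f g f' g' : ℝ → ℝ} (hf : ∀ x, HasDerivAt f (f' x) x)
    (hg : ∀ x, HasDerivAt g (g' x) x) (h0 : f 0 = g 0) (hle : ∀ x, 0 ≤ x → f' x ≤ g' x)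
    {x : ℝ} (hx : 0 ≤ x) : f x ≤ g x := by
  have hd : ∀ x, HasDerivAt (g - f) (g' x - f' x) x := fun x => (hg x).sub (hf x)
  have hmono : MonotoneOn (g - f) (Set.Ici 0) := by
    refine monotoneOn_of_deriv_nonneg (convex_Ici 0)
      (fun y _ => (hd y).continuousAt.continuousWithinAt)
      (fun y _ => (hd y).differentiableAt.differentiableWithinAt) fun y hy => ?_
    rw [interior_Ici] at hy
    rw [(hd y).deriv]
    exact sub_nonneg.mpr (hle y (le_of_lt hy))
  have := hmono Set.self_mem_Ici hx hx
  simp only [Pi.sub_apply] at this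
  linarith

lemma fdLambda_one_one (p : ℕ) (θ : ℝ) :
    fdLambda p 1 1 θ = ∑ j ∈ Finset.Icc 1 p, fdAlpha p j * sin (j * θ) / j := by
  simp [fdLambda, mul_comm θ]

lemma fdMu_one_one (p : ℕ) (θ : ℝ) :
    fdMu p 1 1 θ = ∑ j ∈ Finset.Icc 1 p, fdAlpha p j * (2 - 2 * cos (j * θ)) / (j : ℝ) ^ 2 := by
  simp [fdMu, mul_comm θ]

lemma fdLambda_eq_fdLambda_one_one (p : ℕ) (ω h k : ℝ) :
    fdLambda p ω h k = fdLambda p 1 1 (ω * k * h) / h := by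
  rw [fdLambda_one_one, fdLambda, Finset.sum_div]
  refine Finset.sum_congr rfl fun j _ => ?_
  rw [div_div, show ω * k * j * h = j * (ω * k * h) by ring]

lemma fdMu_eq_fdMu_one_one (p : ℕ) (ω h k : ℝ) :
    fdMu p ω h k = fdMu p 1 1 (ω * k * h) / h ^ 2 := by
  rw [fdMu_one_one, fdMu, Finset.sum_div]
  refine Finset.sum_congr rfl fun j _ => ?_
  rw [div_div, mul_pow, show ω * k * j * h = j * (ω * k * h) by ring]

lemma hasDerivAt_fdLambda (p : ℕ) (θ : ℝ) :
    HasDerivAt (fdLambda p 1 1) (∑ j ∈ Finset.Icc 1 p, fdAlpha p j * cos (j * θ)) θ := by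
  rw [funext (fdLambda_one_one p)]
  refine HasDerivAt.fun_sum fun j hj => ?_
  have hj0 : (j : ℝ) ≠ 0 := by
    have := (Finset.mem_Icc.mp hj).1
    positivity
  have h := ((((hasDerivAt_id θ).const_mul (j : ℝ)).sin).const_mul (fdAlpha p j)).div_const (j : ℝ)
  refine h.congr_deriv ?_
  simp only [id]
  field_simp

lemma hasDerivAt_fdMu (p : ℕ) (θ : ℝ) :
    HasDerivAt (fdMu p 1 1) (2 * fdLambda p 1 1 θ) θ := by
  rw [funext (fdMu_one_one p), fdLambda_one_one, Finset.mul_sum]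
  refine HasDerivAt.fun_sum fun j hj => ?_
  have hj0 : (j : ℝ) ≠ 0 := by
    have := (Finset.mem_Icc.mp hj).1
    positivity
  have h := (((((hasDerivAt_id θ).const_mul (j : ℝ)).cos.const_mul 2).const_sub 2).const_mul
    (fdAlpha p j)).div_const ((j : ℝ) ^ 2)
  refine h.congr_deriv ?_
  simp only [id]
  field_simp

lemma fdLambda_zero (p : ℕ) : fdLambda p 1 1 0 = 0 := by simp [fdLambda]

lemma fdMu_zero (p : ℕ) : fdMu p 1 1 0 = 0 := by simp [fdMu]

lemma fdLambda_neg (p : ℕ) (θ : ℝ) : fdLambda p 1 1 (-θ) = -fdLambda p 1 1 θ := by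
  simp [fdLambda_one_one, neg_div]

lemma fdMu_neg (p : ℕ) (θ : ℝ) : fdMu p 1 1 (-θ) = fdMu p 1 1 θ := by
  simp [fdMu_one_one]

lemma fdLambda_pi (p : ℕ) : fdLambda p 1 1 π = 0 := by
  simp [fdLambda_one_one, sin_nat_mul_pi]

lemma fdLambda_add_int_mul_two_pi (p : ℕ) (θ : ℝ) (n : ℤ) :
    fdLambda p 1 1 (θ + n * (2 * π)) = fdLambda p 1 1 θ := by
  rw [fdLambda_one_one, fdLambda_one_one]
  refine Finset.sum_congr rfl fun j _ => ?_
  have h := sin_add_int_mul_two_pi (j * θ) (j * n)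
  push_cast at h
  rw [← h]
  ring_nf

lemma fdLambda_le_self (p : ℕ) {θ : ℝ} (hθ : 0 ≤ θ) : fdLambda p 1 1 θ ≤ θ :=
  le_of_hasDerivAt_le_of_nonneg (hasDerivAt_fdLambda p) hasDerivAt_id (fdLambda_zero p)
    (fun x _ => sub_nonneg.mp (one_sub_sum_fdAlpha_mul_cos_nonneg p x)) hθ

lemma self_sub_fdLambda_le (p : ℕ) {θ : ℝ} (hθ : 0 ≤ θ) :
    θ - fdLambda p 1 1 θ ≤
      (p.factorial : ℝ) ^ 2 / (2 * p + 1).factorial * θ ^ (2 * p + 1) := by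
  refine le_of_hasDerivAt_le_of_nonneg (f := fun x => x - fdLambda p 1 1 x)
    (g := fun x => (p.factorial : ℝ) ^ 2 / (2 * p + 1).factorial * x ^ (2 * p + 1))
    (fun x => (hasDerivAt_id x).sub (hasDerivAt_fdLambda p x))
    (fun x => (hasDerivAt_pow (2 * p + 1) x).const_mul _) (by simp [fdLambda_zero])
    (fun x _ => (one_sub_sum_fdAlpha_mul_cos_le p x).trans_eq ?_) hθ
  rw [Nat.factorial_succ]
  push_cast
  field_simp

lemma fdMu_le_sq (p : ℕ) {θ : ℝ} (hθ : 0 ≤ θ) : fdMu p 1 1 θ ≤ θ ^ 2 := by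
  refine le_of_hasDerivAt_le_of_nonneg (hasDerivAt_fdMu p) (fun x => hasDerivAt_pow 2 x)
    (by simp [fdMu_zero]) (fun x hx => ?_) hθ
  have := fdLambda_le_self p hx
  simpa using this

lemma sq_sub_fdMu_le (p : ℕ) {θ : ℝ} (hθ : 0 ≤ θ) :
    θ ^ 2 - fdMu p 1 1 θ ≤
      2 * (p.factorial : ℝ) ^ 2 / (2 * p + 2).factorial * θ ^ (2 * p + 2) := by
  refine le_of_hasDerivAt_le_of_nonneg (f := fun x => x ^ 2 - fdMu p 1 1 x)
    (g := fun x => 2 * (p.factorial : ℝ) ^ 2 / (2 * p + 2).factorial * x ^ (2 * p + 2))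
    (fun x => (hasDerivAt_pow 2 x).sub (hasDerivAt_fdMu p x))
    (fun x => (hasDerivAt_pow (2 * p + 2) x).const_mul _) (by simp [fdMu_zero])
    (fun x hx => ?_) hθ
  have h := self_sub_fdLambda_le p hx
  have heq : 2 * (p.factorial : ℝ) ^ 2 / (2 * p + 2).factorial *
      (((2 * p + 2 : ℕ) : ℝ) * x ^ (2 * p + 2 - 1)) =
      2 * ((p.factorial : ℝ) ^ 2 / (2 * p + 1).factorial * x ^ (2 * p + 1)) := by
    rw [Nat.factorial_succ (2 * p + 1), show 2 * p + 2 - 1 = 2 * p + 1 by omega]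
    push_cast
    field_simp
    ring
  rw [heq]
  norm_num
  linarith

/-- `fdLambda` is concave on `[0, π]` and vanishes at both endpoints. -/
lemma fdLambda_nonneg (p : ℕ) {θ : ℝ} (h0 : 0 ≤ θ) (hπ : θ ≤ π) : 0 ≤ fdLambda p 1 1 θ := by
  have hconc : ConcaveOn ℝ (Set.Icc 0 π) (fdLambda p 1 1) := by
    refine AntitoneOn.concaveOn_of_deriv (convex_Icc 0 π)
      (fun y _ => (hasDerivAt_fdLambda p y).continuousAt.continuousWithinAt)
      (fun y _ => (hasDerivAt_fdLambda p y).differentiableAt.differentiableWithinAt) ?_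
    intro x hx y hy hxy
    rw [interior_Icc] at hx hy
    rw [(hasDerivAt_fdLambda p x).deriv, (hasDerivAt_fdLambda p y).deriv]
    have hcos : cos y ≤ cos x := cos_le_cos_of_nonneg_of_le_pi hx.1.le hy.2.le hxy
    have hle : (p.factorial : ℝ) ^ 2 / (2 * p).factorial * (2 - 2 * cos x) ^ p ≤
        (p.factorial : ℝ) ^ 2 / (2 * p).factorial * (2 - 2 * cos y) ^ p := by
      have := two_sub_two_mul_cos_nonneg x
      gcongr
    rw [← one_sub_sum_fdAlpha_mul_cos, ← one_sub_sum_fdAlpha_mul_cos] at hle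
    linarith
  have hmin := hconc.min_le_of_mem_Icc (Set.left_mem_Icc.mpr pi_nonneg)
    (Set.right_mem_Icc.mpr pi_nonneg) ⟨h0, hπ⟩
  simpa [fdLambda_zero, fdLambda_pi] using hmin

lemma abs_fdLambda_abs (p : ℕ) (θ : ℝ) : |fdLambda p 1 1 (|θ|)| = |fdLambda p 1 1 θ| := by
  rcases abs_choice θ with h | h <;> simp [h, fdLambda_neg]

lemma abs_fdLambda_le_abs (p : ℕ) (θ : ℝ) : |fdLambda p 1 1 θ| ≤ |θ| := by
  have hsmall : ∀ x : ℝ, |x| ≤ π → |fdLambda p 1 1 x| ≤ |x| := fun x hx => by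
    rw [← abs_fdLambda_abs, abs_of_nonneg (fdLambda_nonneg p (abs_nonneg x) hx)]
    exact fdLambda_le_self p (abs_nonneg x)
  rcases le_total |θ| π with h | h
  · exact hsmall θ h
  · have hr : |θ - round (θ / (2 * π)) * (2 * π)| ≤ π := by
      have hpos : 0 < 2 * π := two_pi_pos
      have h1 := abs_sub_round (θ / (2 * π))
      have h2 : θ - round (θ / (2 * π)) * (2 * π) =
          (θ / (2 * π) - round (θ / (2 * π))) * (2 * π) := by
        field_simp
      rw [h2, abs_mul, abs_of_pos hpos]
      nlinarith
    have hper := fdLambda_add_int_mul_two_pi p (θ - round (θ / (2 * π)) * (2 * π))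
      (round (θ / (2 * π)))
    rw [sub_add_cancel] at hper
    rw [hper]
    exact (hsmall _ hr).trans (hr.trans h)

lemma abs_self_sub_fdLambda_le (p : ℕ) (θ : ℝ) :
    |θ - fdLambda p 1 1 θ| ≤
      (p.factorial : ℝ) ^ 2 / (2 * p + 1).factorial * |θ| ^ (2 * p + 1) := by
  have habs : |(|θ| - fdLambda p 1 1 |θ|)| = |θ - fdLambda p 1 1 θ| := by
    rcases abs_choice θ with h | h <;> rw [h]
    rw [fdLambda_neg, ← neg_sub', abs_neg]
  rw [← habs, abs_of_nonneg (sub_nonneg.mpr (fdLambda_le_self p (abs_nonneg θ)))]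
  exact self_sub_fdLambda_le p (abs_nonneg θ)

lemma abs_sq_sub_fdLambda_sq_le (p : ℕ) (θ : ℝ) :
    |θ ^ 2 - fdLambda p 1 1 θ ^ 2| ≤
      2 * (p.factorial : ℝ) ^ 2 / (2 * p + 1).factorial * |θ| ^ (2 * p + 2) := by
  have hadd : |θ + fdLambda p 1 1 θ| ≤ 2 * |θ| := by
    linarith [abs_add_le θ (fdLambda p 1 1 θ), abs_fdLambda_le_abs p θ]
  calc |θ ^ 2 - fdLambda p 1 1 θ ^ 2|
      = |θ + fdLambda p 1 1 θ| * |θ - fdLambda p 1 1 θ| := by rw [← abs_mul, sq_sub_sq]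
    _ ≤ (2 * |θ|) *
        ((p.factorial : ℝ) ^ 2 / (2 * p + 1).factorial * |θ| ^ (2 * p + 1)) :=
      mul_le_mul hadd (abs_self_sub_fdLambda_le p θ) (abs_nonneg _) (by positivity)
    _ = _ := by ring

lemma abs_sq_sub_fdMu_le (p : ℕ) (θ : ℝ) :
    |θ ^ 2 - fdMu p 1 1 θ| ≤
      2 * (p.factorial : ℝ) ^ 2 / (2 * p + 2).factorial * |θ| ^ (2 * p + 2) := by
  have habs : fdMu p 1 1 |θ| = fdMu p 1 1 θ := by
    rcases abs_choice θ with h | h <;> simp [h, fdMu_neg]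
  rw [← habs, ← sq_abs, abs_of_nonneg (sub_nonneg.mpr (fdMu_le_sq p (abs_nonneg θ)))]
  exact sq_sub_fdMu_le p (abs_nonneg θ)

/-- Approximation estimates for the eigenvalue symbols:
`|ωk − λ_k| ≤ ((p!)²/(2p+1)!)|ωk|^{2p+1}(Δx)^{2p}`,
`|ω²k² − λ_k²| ≤ (2(p!)²/(2p+1)!)|ωk|^{2p+2}(Δx)^{2p}`, and
`|ω²k² − μ_k| ≤ (2(p!)²/(2p+2)!)|ωk|^{2p+2}(Δx)^{2p}`. -/
theorem lambda_mu_estimates (p : ℕ) (hp : 1 ≤ p) (d : ℝ) (hd : 0 < d)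
    (N : ℕ) (hN : 0 < N) (ω Δx : ℝ) (hω : ω = 2 * Real.pi / d) (hΔx : Δx = d / N)
    (k : ℝ) :
    |ω * k - fdLambda p ω Δx k| ≤
      ((p.factorial : ℝ) ^ 2 / (2 * p + 1).factorial) * |ω * k| ^ (2 * p + 1) *
        Δx ^ (2 * p) ∧
    |ω ^ 2 * k ^ 2 - (fdLambda p ω Δx k) ^ 2| ≤
      (2 * (p.factorial : ℝ) ^ 2 / (2 * p + 1).factorial) * |ω * k| ^ (2 * p + 2) *
        Δx ^ (2 * p) ∧
    |ω ^ 2 * k ^ 2 - fdMu p ω Δx k| ≤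
      (2 * (p.factorial : ℝ) ^ 2 / (2 * p + 2).factorial) * |ω * k| ^ (2 * p + 2) *
        Δx ^ (2 * p) := by
  have hh : 0 < Δx := by rw [hΔx]; positivity
  have habs : |ω * k * Δx| = |ω * k| * Δx := by rw [abs_mul, abs_of_pos hh]
  have h1 := abs_self_sub_fdLambda_le p (ω * k * Δx)
  have h2 := abs_sq_sub_fdLambda_sq_le p (ω * k * Δx)
  have h3 := abs_sq_sub_fdMu_le p (ω * k * Δx)
  rw [habs] at h1 h2 h3
  rw [fdLambda_eq_fdLambda_one_one, fdMu_eq_fdMu_one_one]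
  have hsq : 0 < Δx ^ 2 := by positivity
  refine ⟨?_, ?_, ?_⟩
  · have heq : ω * k - fdLambda p 1 1 (ω * k * Δx) / Δx =
        (ω * k * Δx - fdLambda p 1 1 (ω * k * Δx)) / Δx := by field_simp
    rw [heq, abs_div, abs_of_pos hh, div_le_iff₀ hh]
    exact h1.trans_eq (by ring)
  · have heq : ω ^ 2 * k ^ 2 - (fdLambda p 1 1 (ω * k * Δx) / Δx) ^ 2 =
        ((ω * k * Δx) ^ 2 - fdLambda p 1 1 (ω * k * Δx) ^ 2) / Δx ^ 2 := by field_simp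
    rw [heq, abs_div, abs_of_pos hsq, div_le_iff₀ hsq]
    exact h2.trans_eq (by ring)
  · have heq : ω ^ 2 * k ^ 2 - fdMu p 1 1 (ω * k * Δx) / Δx ^ 2 =
        ((ω * k * Δx) ^ 2 - fdMu p 1 1 (ω * k * Δx)) / Δx ^ 2 := by field_simp
    rw [heq, abs_div, abs_of_pos hsq, div_le_iff₀ hsq]
    exact h3.trans_eq (by ring)
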